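/- Optimal Gaussian posterior covariance under a quadratic loss approximation (matrix form): Let k ≥ 1, let H be a symmetric positive semidefinite real k×k matrix, let λ > 0 and t > 0 (playing the role of nβ), and set H_λ = t·H + λ·I_k, which is positive definite. Fix vectors w_P, w_Q ∈ ℝ^k and define, for every symmetric positive definite k×k matrix Σ, F(Σ) = (1/2)·tr(HΣ) + (1/(2t))·( ln( det(λ⁻¹·I_k)/det Σ ) + λ·tr(Σ) − k + λ·‖w_Q − w_P‖² ). Then for every symmetric positive definite Σ, F(Σ) ≥ F(H_λ⁻¹); i.e. the minimizer of F over positive definite covariances is Σ* = H_λ⁻¹. -/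

import Mathlib

open Matrix

/-- The objective `F(Σ) = E_{N(w_P,Σ)}[(1/2)(W−w_P)ᵀH(W−w_P)] + (1/t)·D(N(w_P,Σ)‖N(w_Q,λ⁻¹I))`,
written via the closed-form Gaussian KL divergence. -/
noncomputable def gaussObjective (k : ℕ) (H : Matrix (Fin k) (Fin k) ℝ) (lam t : ℝ)
    (wP wQ : Fin k → ℝ) (S : Matrix (Fin k) (Fin k) ℝ) : ℝ :=
  (1 / 2) * (H * S).trace
    + (1 / (2 * t)) * (Real.log ((lam⁻¹ • (1 : Matrix (Fin k) (Fin k) ℝ)).det / S.det)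
        + lam * S.trace - k + lam * ∑ i, (wQ i - wP i) ^ 2)

/-- The inequality `log x ≤ x - 1`, summed over the eigenvalues of a positive definite matrix. -/
lemma log_det_le_trace_sub_card {n : Type*} [Fintype n] [DecidableEq n] {A : Matrix n n ℝ}
    (hA : A.PosDef) : Real.log A.det ≤ A.trace - Fintype.card n := by
  rw [hA.isHermitian.det_eq_prod_eigenvalues, hA.isHermitian.trace_eq_sum_eigenvalues]
  simp only [RCLike.ofReal_real_eq_id, id_eq]
  rw [Real.log_prod fun i _ ↦ (hA.eigenvalues_pos i).ne']
  calc ∑ i, Real.log (hA.isHermitian.eigenvalues i)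
      ≤ ∑ i, (hA.isHermitian.eigenvalues i - 1) :=
        Finset.sum_le_sum fun i _ ↦ Real.log_le_sub_one_of_pos (hA.eigenvalues_pos i)
    _ = _ := by simp [Finset.sum_sub_distrib]

open scoped MatrixOrder Matrix.Norms.L2Operator in
lemma log_det_mul_le_trace_mul_sub_card {n : Type*} [Fintype n] [DecidableEq n]
    {A B : Matrix n n ℝ} (hA : A.PosDef) (hB : B.PosDef) :
    Real.log (A.det * B.det) ≤ (A * B).trace - Fintype.card n := by
  obtain ⟨C, rfl⟩ := CStarAlgebra.nonneg_iff_eq_star_mul_self.mp hB.posSemidef.nonneg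
  have hC : IsUnit C := by
    have h := hB.det_pos.ne'
    rw [det_mul] at h
    exact (isUnit_iff_isUnit_det C).mpr (right_ne_zero_of_mul h).isUnit
  have h := log_det_le_trace_sub_card
    (hA.mul_mul_conjTranspose_same (vecMul_injective_iff_isUnit.mpr hC))
  rw [trace_mul_comm, ← mul_assoc, trace_mul_comm, ← star_eq_conjTranspose] at h
  convert h using 2
  simp only [det_mul, star_eq_conjTranspose]
  ring

lemma gaussObjective_eq {k : ℕ} (H : Matrix (Fin k) (Fin k) ℝ) {lam t : ℝ} (hlam : 0 < lam)
    (ht : 0 < t) (wP wQ : Fin k → ℝ) {S : Matrix (Fin k) (Fin k) ℝ} (hS : S.PosDef) :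
    gaussObjective k H lam t wP wQ S =
      (1 / (2 * t)) * (((t • H + lam • (1 : Matrix (Fin k) (Fin k) ℝ)) * S).trace
        - Real.log S.det + (Real.log (lam⁻¹ • (1 : Matrix (Fin k) (Fin k) ℝ)).det - k
        + lam * ∑ i, (wQ i - wP i) ^ 2)) := by
  have hdet : (lam⁻¹ • (1 : Matrix (Fin k) (Fin k) ℝ)).det ≠ 0 :=
    (PosDef.one.smul (inv_pos.mpr hlam)).det_pos.ne'
  rw [gaussObjective, Real.log_div hdet hS.det_pos.ne']
  simp only [add_mul, smul_mul_assoc, one_mul, trace_add, trace_smul, smul_eq_mul]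
  field_simp
  ring

/-- **Optimal Gaussian posterior covariance under a quadratic loss approximation.**
For `H` positive semidefinite, `λ, t > 0`, the matrix `H_λ = t·H + λ·I` is positive definite,
and the objective `F` is minimized over positive definite covariances at `Σ* = H_λ⁻¹`. -/
theorem gauss_posterior_covariance_optimal
    (k : ℕ) (hk : 1 ≤ k)
    (H : Matrix (Fin k) (Fin k) ℝ) (hH : H.PosSemidef)
    (lam t : ℝ) (hlam : 0 < lam) (ht : 0 < t)
    (wP wQ : Fin k → ℝ) :
    (t • H + lam • (1 : Matrix (Fin k) (Fin k) ℝ)).PosDef ∧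
    ∀ S : Matrix (Fin k) (Fin k) ℝ, S.PosDef →
      gaussObjective k H lam t wP wQ S ≥
        gaussObjective k H lam t wP wQ (t • H + lam • (1 : Matrix (Fin k) (Fin k) ℝ))⁻¹ := by
  have hA : (t • H + lam • (1 : Matrix (Fin k) (Fin k) ℝ)).PosDef :=
    PosDef.posSemidef_add (hH.smul ht.le) (PosDef.one.smul hlam)
  refine ⟨hA, fun S hS ↦ ?_⟩
  rw [ge_iff_le, gaussObjective_eq H hlam ht wP wQ hS, gaussObjective_eq H hlam ht wP wQ hA.inv]
  have h := log_det_mul_le_trace_mul_sub_card hA hS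
  rw [Real.log_mul hA.det_pos.ne' hS.det_pos.ne', Fintype.card_fin] at h
  rw [mul_nonsing_inv _ hA.det_pos.ne'.isUnit, trace_one, Fintype.card_fin, det_nonsing_inv,
    Ring.inverse_eq_inv', Real.log_inv]
  gcongr ?_ * (?_ + _)
  linarith
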